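/- Let f : ℝ^d → ℝ be twice continuously differentiable with ‖∇f(x) − ∇f(y)‖ ≤ ℓ‖x − y‖ and ‖∇²f(x) − ∇²f(y)‖ ≤ ρ‖x − y‖ for all x, y (operator norms), and let η ≥ 0. Define the one-step MAML objective F(x) = f(x − η∇f(x)). Then for all u, w ∈ ℝ^d, ‖∇F(u) − ∇F(w)‖ ≤ ( ℓ·(1 + ηℓ)² + η·ρ·‖∇f(w − η∇f(w))‖ )·‖u − w‖; in particular ∇F(x) = (I − η∇²f(x))·∇f(x − η∇f(x)). -/

import Mathlib

open scoped RealInnerProductSpace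

section Hessian

variable {E : Type*} [NormedAddCommGroup E] [InnerProductSpace ℝ E] [CompleteSpace E] {f : E → ℝ}

theorem ContDiff.differentiable_gradient (hf : ContDiff ℝ 2 f) :
    Differentiable ℝ (gradient f) :=
  (InnerProductSpace.toDual ℝ E).symm.differentiable.comp
    ((hf.fderiv_right (m := 1) (by norm_num)).differentiable (by norm_num))

theorem ContDiff.inner_fderiv_gradient (hf : ContDiff ℝ 2 f) (x v w : E) :
    ⟪fderiv ℝ (gradient f) x v, w⟫ = fderiv ℝ (fderiv ℝ f) x v w := by
  have hd : DifferentiableAt ℝ (fderiv ℝ f) x :=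
    (hf.fderiv_right (m := 1) (by norm_num)).differentiable (by norm_num) x
  have h := ((InnerProductSpace.toDual ℝ E).symm.toContinuousLinearEquiv.hasFDerivAt
    (x := fderiv ℝ f x)).comp x hd.hasFDerivAt
  have h' : fderiv ℝ (gradient f) x v
      = (InnerProductSpace.toDual ℝ E).symm (fderiv ℝ (fderiv ℝ f) x v) :=
    congrArg (fun L => L v) h.fderiv
  rw [h', InnerProductSpace.toDual_symm_apply]

/-- The Hessian of a twice continuously differentiable function is symmetric. -/
theorem ContDiff.inner_fderiv_gradient_comm (hf : ContDiff ℝ 2 f) (x v w : E) :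
    ⟪fderiv ℝ (gradient f) x v, w⟫ = ⟪v, fderiv ℝ (gradient f) x w⟫ := by
  rw [real_inner_comm _ v, hf.inner_fderiv_gradient, hf.inner_fderiv_gradient]
  exact (hf.contDiffAt.isSymmSndFDerivAt (by simp)).eq v w

/-- The gradient of `x ↦ f (x - η ∇f(x))`. -/
theorem ContDiff.hasGradientAt_comp_gradient_step (hf : ContDiff ℝ 2 f) (η : ℝ) (x : E) :
    HasGradientAt (fun y => f (y - η • gradient f y))
      (gradient f (x - η • gradient f x)
        - η • fderiv ℝ (gradient f) x (gradient f (x - η • gradient f x))) x := by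
  have hstep := (hasFDerivAt_id x).sub ((hf.differentiable_gradient x).hasFDerivAt.const_smul η)
  have hout := ((hf.differentiable (by norm_num))
    (x - η • gradient f x)).hasGradientAt.hasFDerivAt
  rw [hasGradientAt_iff_hasFDerivAt]
  refine (HasFDerivAt.comp x hout hstep).congr_fderiv ?_
  ext v
  change ⟪gradient f (x - η • gradient f x), v - η • fderiv ℝ (gradient f) x v⟫ = ⟪_ - _, v⟫
  rw [inner_sub_left, inner_sub_right, real_inner_smul_left, real_inner_smul_right,
    hf.inner_fderiv_gradient_comm]

end Hessian

/-- Smoothness of the one-step MAML objective `F(x) = f(x − η∇f(x))`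
for a twice continuously differentiable `f` with Lipschitz gradient and Lipschitz
Hessian, together with the formula `∇F(x) = (I − η∇²f(x))·∇f(x − η∇f(x))`. -/
theorem maml_objective_grad_lipschitz (d : ℕ)
    (f : EuclideanSpace ℝ (Fin d) → ℝ) (hf : ContDiff ℝ 2 f)
    (ℓ ρ : ℝ)
    (hgradLip : ∀ x y, ‖gradient f x - gradient f y‖ ≤ ℓ * ‖x - y‖)
    (hhessLip : ∀ x y,
      ‖fderiv ℝ (gradient f) x - fderiv ℝ (gradient f) y‖ ≤ ρ * ‖x - y‖)
    (η : ℝ) (hη : 0 ≤ η)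
    (F : EuclideanSpace ℝ (Fin d) → ℝ)
    (hF : ∀ x, F x = f (x - η • gradient f x)) :
    (∀ u w, ‖gradient F u - gradient F w‖ ≤
        (ℓ * (1 + η * ℓ) ^ 2 + η * ρ * ‖gradient f (w - η • gradient f w)‖)
          * ‖u - w‖) ∧
    (∀ x, gradient F x =
        gradient f (x - η • gradient f x)
          - η • fderiv ℝ (gradient f) x (gradient f (x - η • gradient f x))) := by
  have hform : ∀ x, gradient F x =
      gradient f (x - η • gradient f x)
        - η • fderiv ℝ (gradient f) x (gradient f (x - η • gradient f x)) := by
    intro x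
    rw [funext hF]
    exact (hf.hasGradientAt_comp_gradient_step η x).gradient
  refine ⟨fun u w => ?_, hform⟩
  rcases eq_or_ne u w with rfl | huw
  · simp
  have hpos : 0 < ‖u - w‖ := norm_pos_iff.2 (sub_ne_zero.2 huw)
  have hℓ : 0 ≤ ℓ :=
    nonneg_of_mul_nonneg_left ((norm_nonneg _).trans (hgradLip u w)) hpos
  have hhess : ‖fderiv ℝ (gradient f) u‖ ≤ ℓ :=
    (hf.differentiable_gradient u).hasFDerivAt.le_of_lip' hℓ
      (Filter.Eventually.of_forall fun y => hgradLip y u)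
  rw [hform u, hform w]
  set a := gradient f (u - η • gradient f u)
  set b := gradient f (w - η • gradient f w)
  have hstep : ‖(u - η • gradient f u) - (w - η • gradient f w)‖ ≤ (1 + η * ℓ) * ‖u - w‖ := by
    calc _ = ‖(u - w) - η • (gradient f u - gradient f w)‖ := by
          congr 1; module
      _ ≤ ‖u - w‖ + η * ‖gradient f u - gradient f w‖ := by
          refine (norm_sub_le _ _).trans_eq ?_
          rw [norm_smul, Real.norm_of_nonneg hη]
      _ ≤ ‖u - w‖ + η * (ℓ * ‖u - w‖) := by gcongr; exact hgradLip u w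
      _ = _ := by ring
  have hab : ‖a - b‖ ≤ ℓ * ((1 + η * ℓ) * ‖u - w‖) :=
    (hgradLip _ _).trans (mul_le_mul_of_nonneg_left hstep hℓ)
  calc _ = ‖(a - b) - η • fderiv ℝ (gradient f) u (a - b)
          - η • (fderiv ℝ (gradient f) u - fderiv ℝ (gradient f) w) b‖ := by
        congr 1
        rw [map_sub, sub_apply]
        module
    _ ≤ ‖a - b‖ + η * ‖fderiv ℝ (gradient f) u (a - b)‖
          + η * ‖(fderiv ℝ (gradient f) u - fderiv ℝ (gradient f) w) b‖ := by
        refine (norm_sub_le _ _).trans (add_le_add ((norm_sub_le _ _).trans_eq ?_) (le_of_eq ?_)) <;>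
          rw [norm_smul, Real.norm_of_nonneg hη]
    _ ≤ ‖a - b‖ + η * (ℓ * ‖a - b‖) + η * ((ρ * ‖u - w‖) * ‖b‖) := by
        gcongr
        · exact ContinuousLinearMap.le_of_opNorm_le _ hhess _
        · exact ContinuousLinearMap.le_of_opNorm_le _ (hhessLip u w) _
    _ = (1 + η * ℓ) * ‖a - b‖ + η * ρ * ‖b‖ * ‖u - w‖ := by ring
    _ ≤ (1 + η * ℓ) * (ℓ * ((1 + η * ℓ) * ‖u - w‖)) + η * ρ * ‖b‖ * ‖u - w‖ := by gcongr
    _ = _ := by ring
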